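/- Let f, h : ℝ² → ℝ² be commuting lifts of commuting torus homeomorphisms homotopic to the identity. Suppose the rotation set ρ(f) is a nondegenerate segment of rational slope containing a rational point, and ρ(h) has nonempty interior. Then f and h do not commute — contradiction; i.e., there are no such commuting f and h. -/

import Mathlib

open Filter Topology MeasureTheory

noncomputable section

/-- The plane ℝ². -/
abbrev V2 : Type := ℝ × ℝ

/-- Euclidean dot product on ℝ². -/
def dot (x y : V2) : ℝ := x.1 * y.1 + x.2 * y.2

/-- Euclidean norm on ℝ². -/
def nrm (x : V2) : ℝ := Real.sqrt (dot x x)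

/-- v^⊥ = (−v₂, v₁). -/
def perp (v : V2) : V2 := (-v.2, v.1)

/-- Inclusion of ℤ² into ℝ². -/
def intVec (u : ℤ × ℤ) : V2 := ((u.1 : ℝ), (u.2 : ℝ))

/-- `f` is a lift of a torus map: it commutes with all integer translations. -/
def IsLift (f : V2 → V2) : Prop := ∀ (z : V2) (u : ℤ × ℤ), f (z + intVec u) = f z + intVec u

/-- The Misiurewicz–Ziemian rotation set of `f`. -/
def RotSet (f : V2 → V2) : Set V2 :=
  {v | ∃ (n : ℕ → ℕ) (x : ℕ → V2), Tendsto n atTop atTop ∧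
    Tendsto (fun i => ((n i : ℝ))⁻¹ • (f^[n i] (x i) - x i)) atTop (𝓝 v)}


open Real in
lemma aux_edge (φ : ℝ → ℝ) (hφ : Continuous φ) (h0 : ∀ t ∈ Set.Icc (0:ℝ) 1, 0 ≤ cos (φ t))
    (h1 : -(π/2) ≤ φ 0) (h2 : φ 0 ≤ π/2) : -(π/2) ≤ φ 1 ∧ φ 1 ≤ π/2 := by
  have hpi := Real.pi_pos
  constructor
  · by_contra hc
    push Not at hc
    set c := max (φ 1) (-π) with hcdef
    have hc1 : φ 1 ≤ c := le_max_left _ _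
    have hc2 : -π ≤ c := le_max_right _ _
    have hc3 : c < -(π/2) := max_lt hc (by linarith)
    have := intermediate_value_Icc' (zero_le_one) (hφ.continuousOn (s := Set.Icc 0 1))
    obtain ⟨t, ht, hte⟩ := this ⟨hc1, (by linarith : c ≤ φ 0)⟩
    have h3 := h0 t ht
    rw [hte, ← Real.cos_neg] at h3
    have := Real.cos_neg_of_pi_div_two_lt_of_lt (x := -c) (by linarith) (by linarith)
    linarith
  · by_contra hc
    push Not at hc
    set c := min (φ 1) (π) with hcdef
    have hc1 : c ≤ φ 1 := min_le_left _ _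
    have hc2 : c ≤ π := min_le_right _ _
    have hc3 : π/2 < c := lt_min hc (by linarith)
    have := intermediate_value_Icc (zero_le_one) (hφ.continuousOn (s := Set.Icc 0 1))
    obtain ⟨t, ht, hte⟩ := this ⟨(by linarith : φ 0 ≤ c), hc1⟩
    have h3 := h0 t ht
    rw [hte] at h3
    have := Real.cos_neg_of_pi_div_two_lt_of_lt (x := c) (by linarith) (by linarith)
    linarith

open Real in
lemma aux_sin (x : ℝ) (h1 : -(π/2) ≤ x) (h3 : 0 ≤ sin x) : 0 ≤ x := by
  by_contra hc
  push Not at hc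
  have := Real.sin_neg_of_neg_of_neg_pi_lt hc (by linarith [Real.pi_pos])
  linarith

open Real in
lemma aux_edge2 (φ : ℝ → ℝ) (hφ : Continuous φ) (h0 : ∀ t ∈ Set.Icc (0:ℝ) 1, 0 ≤ cos (φ t))
    (h1 : -(π/2) ≤ φ 0) (h2 : φ 0 ≤ π/2) (h3 : 0 ≤ sin (φ 1)) : 0 ≤ φ 1 ∧ φ 1 ≤ π/2 := by
  obtain ⟨a, b⟩ := aux_edge φ hφ h0 h1 h2
  exact ⟨aux_sin _ a h3, b⟩

open Real in
lemma miranda_aux (F : ℝ × ℝ → ℂ) (hF : Continuous F) (hne : ∀ x, F x ≠ 0)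
    (e1 : ∀ t ∈ Set.Icc (0:ℝ) 1, 0 ≤ (F (0,t)).re)
    (e2 : ∀ t ∈ Set.Icc (0:ℝ) 1, (F (1,t)).re ≤ 0)
    (e3 : ∀ t ∈ Set.Icc (0:ℝ) 1, (F (t,0)).im ≤ 0)
    (e4 : ∀ t ∈ Set.Icc (0:ℝ) 1, 0 ≤ (F (t,1)).im) : False := by
  have hpi := Real.pi_pos
  obtain ⟨L, ⟨hL0, hL⟩, -⟩ := Complex.isCoveringMap_exp.existsUnique_continuousMap_lifts
    (⟨fun x => ⟨F x, hne x⟩, by fun_prop⟩ : C(ℝ × ℝ, {z : ℂ // z ≠ 0})) (0,0)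
    (Complex.log (F (0,0))) (by
      apply Subtype.ext
      exact Complex.exp_log (hne _))
  have hexp : ∀ x, Complex.exp (L x) = F x := fun x => by
    have := congrFun hL x
    exact congrArg Subtype.val this
  have hre : ∀ x, (F x).re = exp (L x).re * cos (L x).im := fun x => by
    rw [← hexp, Complex.exp_re]
  have him : ∀ x, (F x).im = exp (L x).re * sin (L x).im := fun x => by
    rw [← hexp, Complex.exp_im]
  have c1 : ∀ t ∈ Set.Icc (0:ℝ) 1, 0 ≤ cos (L (0,t)).im := fun t ht => by
    have := e1 t ht
    rw [hre] at this
    exact nonneg_of_mul_nonneg_right this (exp_pos _)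
  have c2 : ∀ t ∈ Set.Icc (0:ℝ) 1, 0 ≤ - cos (L (1,t)).im := fun t ht => by
    have := e2 t ht
    rw [hre] at this
    refine nonneg_of_mul_nonneg_right (a := exp (L (1,t)).re) (by linarith) (exp_pos _)
  have c3 : ∀ t ∈ Set.Icc (0:ℝ) 1, 0 ≤ - sin (L (t,0)).im := fun t ht => by
    have := e3 t ht
    rw [him] at this
    refine nonneg_of_mul_nonneg_right (a := exp (L (t,0)).re) (by linarith) (exp_pos _)
  have c4 : ∀ t ∈ Set.Icc (0:ℝ) 1, 0 ≤ sin (L (t,1)).im := fun t ht => by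
    have := e4 t ht
    rw [him] at this
    exact nonneg_of_mul_nonneg_right this (exp_pos _)
  have m0 : (0:ℝ) ∈ Set.Icc (0:ℝ) 1 := by simp
  have m1 : (1:ℝ) ∈ Set.Icc (0:ℝ) 1 := by simp
  have hcL := L.continuous
  have harg : (L (0,0)).im = Complex.arg (F (0,0)) := by rw [hL0, Complex.log_im]
  have hb : |(L (0,0)).im| ≤ π/2 := by
    rw [harg]; exact Complex.abs_arg_le_pi_div_two_iff.2 (e1 0 m0)
  obtain ⟨hb1, hb2⟩ := abs_le.1 hb
  have hb3 : 0 ≤ -(L (0,0)).im := aux_sin _ (by linarith) (by rw [sin_neg]; exact c3 0 m0)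
  have s1 := aux_edge2 (fun t => (L (0,t)).im) (by fun_prop) c1 hb1 hb2 (c4 0 m0)
  have s2 := aux_edge2 (fun t => (L (t,1)).im - π/2) (by fun_prop)
    (fun t ht => by rw [cos_sub_pi_div_two]; exact c4 t ht) (by linarith) (by linarith)
    (by rw [sin_sub_pi_div_two]; exact c2 1 m1)
  have s3 := aux_edge2 (fun t => (L (1,1-t)).im - π) (by fun_prop)
    (fun t ht => by
      rw [cos_sub_pi]; exact c2 _ ⟨by linarith [ht.2], by linarith [ht.1]⟩)
    (by simp only [sub_zero]; linarith) (by simp only [sub_zero]; linarith)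
    (by rw [sin_sub_pi]; simp only [sub_self]; exact c3 1 m1)
  simp only [sub_self] at s3
  have s4 := aux_edge (fun t => (L (1-t,0)).im - π - π/2) (by fun_prop)
    (fun t ht => by
      rw [cos_sub_pi_div_two, sin_sub_pi]
      exact c3 _ ⟨by linarith [ht.2], by linarith [ht.1]⟩)
    (by simp only [sub_zero]; linarith) (by simp only [sub_zero]; linarith)
  simp only [sub_self] at s4
  linarith

lemma miranda (F : ℝ × ℝ → ℂ) (hF : Continuous F)
    (e1 : ∀ t ∈ Set.Icc (0:ℝ) 1, 0 ≤ (F (0,t)).re)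
    (e2 : ∀ t ∈ Set.Icc (0:ℝ) 1, (F (1,t)).re ≤ 0)
    (e3 : ∀ t ∈ Set.Icc (0:ℝ) 1, (F (t,0)).im ≤ 0)
    (e4 : ∀ t ∈ Set.Icc (0:ℝ) 1, 0 ≤ (F (t,1)).im) :
    ∃ s ∈ Set.Icc (0:ℝ) 1, ∃ t ∈ Set.Icc (0:ℝ) 1, F (s,t) = 0 := by
  by_contra hc
  push Not at hc
  have key : ∀ x : ℝ, max 0 (min x 1) ∈ Set.Icc (0:ℝ) 1 := fun x =>
    ⟨le_max_left _ _, max_le zero_le_one (min_le_right _ _)⟩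
  have id' : ∀ x ∈ Set.Icc (0:ℝ) 1, max 0 (min x 1) = x := fun x hx => by
    rw [min_eq_left hx.2, max_eq_right hx.1]
  have i0 := id' 0 (by simp)
  have i1 := id' 1 (by simp)
  refine miranda_aux (fun x => F (max 0 (min x.1 1), max 0 (min x.2 1))) (by fun_prop)
    (fun x => hc _ (key _) _ (key _)) ?_ ?_ ?_ ?_
  · intro t ht; simp only [i0, id' t ht]; exact e1 t ht
  · intro t ht; simp only [i1, id' t ht]; exact e2 t ht
  · intro t ht; simp only [i0, id' t ht]; exact e3 t ht
  · intro t ht; simp only [i1, id' t ht]; exact e4 t ht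

lemma dot_add' (x y c : V2) : dot (x + y) c = dot x c + dot y c := by
  simp [dot]; ring

lemma dot_sub' (x y c : V2) : dot (x - y) c = dot x c - dot y c := by
  simp [dot]; ring

lemma dot_smul' (r : ℝ) (x c : V2) : dot (r • x) c = r * dot x c := by
  simp [dot]; ring

lemma dot_cont {Z : Type*} [TopologicalSpace Z] (f : Z → V2) (hf : Continuous f) (c : V2) :
    Continuous fun z => dot (f z) c := by
  unfold dot; fun_prop

lemma dot_perp (V : V2) : dot V (perp V) = 0 := by
  simp [dot, perp]; ring

lemma dot_perp' (V : V2) : dot (perp V) V = 0 := by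
  simp [dot, perp]; ring

lemma dot_perp_perp (V : V2) : dot (perp V) (perp V) = dot V V := by
  simp [dot, perp]; ring

lemma eq_of_dots (V : V2) (hV : 0 < dot V V) (x y : V2) (h1 : dot x V = dot y V)
    (h2 : dot x (perp V) = dot y (perp V)) : x = y := by
  have e1 : dot V V * (x.1 - y.1) = 0 := by
    simp only [dot, perp] at *
    linear_combination V.1 * h1 - V.2 * h2
  have e2 : dot V V * (x.2 - y.2) = 0 := by
    simp only [dot, perp] at *
    linear_combination V.2 * h1 + V.1 * h2
  ext
  · have := (mul_eq_zero.1 e1).resolve_left hV.ne'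
    linarith
  · have := (mul_eq_zero.1 e2).resolve_left hV.ne'
    linarith

lemma cross (V : V2) (hV : 0 < dot V V) (α β : ℝ → V2) (hα : Continuous α) (hβ : Continuous β)
    (e1 : ∀ t ∈ Set.Icc (0:ℝ) 1, dot (β 0) V ≤ dot (α t) V)
    (e2 : ∀ t ∈ Set.Icc (0:ℝ) 1, dot (α t) V ≤ dot (β 1) V)
    (e3 : ∀ s ∈ Set.Icc (0:ℝ) 1, dot (α 0) (perp V) ≤ dot (β s) (perp V))
    (e4 : ∀ s ∈ Set.Icc (0:ℝ) 1, dot (β s) (perp V) ≤ dot (α 1) (perp V)) :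
    ∃ s ∈ Set.Icc (0:ℝ) 1, ∃ t ∈ Set.Icc (0:ℝ) 1, α t = β s := by
  have c1 := dot_cont α hα V
  have c2 := dot_cont α hα (perp V)
  have c3 := dot_cont β hβ V
  have c4 := dot_cont β hβ (perp V)
  obtain ⟨s, hs, t, ht, hst⟩ := miranda
    (fun x => ((dot (α x.2) V - dot (β x.1) V : ℝ) : ℂ)
      + ((dot (α x.2) (perp V) - dot (β x.1) (perp V) : ℝ) : ℂ) * Complex.I)
    (by
      have := c1.comp (continuous_snd (X := ℝ) (Y := ℝ))
      have := c2.comp (continuous_snd (X := ℝ) (Y := ℝ))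
      have := c3.comp (continuous_fst (X := ℝ) (Y := ℝ))
      have := c4.comp (continuous_fst (X := ℝ) (Y := ℝ))
      simp only [Function.comp_def] at *
      fun_prop)
    (fun t ht => by simpa using e1 t ht) (fun t ht => by simpa using e2 t ht)
    (fun t ht => by simpa using e3 t ht) (fun t ht => by simpa using e4 t ht)
  refine ⟨s, hs, t, ht, eq_of_dots V hV _ _ ?_ ?_⟩
  · have := congrArg Complex.re hst
    simp at this
    linarith
  · have := congrArg Complex.im hst
    simp at this
    linarith

lemma trunc (φ : ℝ → ℝ) (hφ : Continuous φ) (K : ℝ) (hK : 0 < K) (h0 : φ 0 ≤ -K) (h1 : K ≤ φ 1) :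
    ∃ a b : ℝ, 0 ≤ a ∧ a ≤ b ∧ b ≤ 1 ∧ φ a = -K ∧ φ b = K ∧ ∀ t ∈ Set.Icc a b, |φ t| ≤ K := by
  -- `b` is the first time `φ = K`
  have hS : IsCompact (Set.Icc (0:ℝ) 1 ∩ φ ⁻¹' {K}) :=
    isCompact_Icc.inter_right (isClosed_singleton.preimage hφ)
  have hSn : (Set.Icc (0:ℝ) 1 ∩ φ ⁻¹' {K}).Nonempty := by
    obtain ⟨t, ht, hte⟩ := intermediate_value_Icc zero_le_one
      (hφ.continuousOn (s := Set.Icc 0 1)) ⟨(by linarith : φ 0 ≤ K), h1⟩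
    exact ⟨t, ht, hte⟩
  obtain ⟨b, ⟨⟨hb0, hb1⟩, hbK⟩, hbmin⟩ := hS.exists_isLeast hSn
  simp only [Set.mem_preimage, Set.mem_singleton_iff] at hbK
  have hT : IsCompact (Set.Icc (0:ℝ) b ∩ φ ⁻¹' {-K}) :=
    isCompact_Icc.inter_right (isClosed_singleton.preimage hφ)
  have hTn : (Set.Icc (0:ℝ) b ∩ φ ⁻¹' {-K}).Nonempty := by
    obtain ⟨t, ht, hte⟩ := intermediate_value_Icc hb0
      (hφ.continuousOn (s := Set.Icc 0 b)) ⟨h0, (by linarith : -K ≤ φ b)⟩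
    exact ⟨t, ht, hte⟩
  obtain ⟨a, ⟨⟨ha0, hab⟩, haK⟩, hamax⟩ := hT.exists_isGreatest hTn
  simp only [Set.mem_preimage, Set.mem_singleton_iff] at haK
  refine ⟨a, b, ha0, hab, hb1, haK, hbK, fun t ht => abs_le.2 ⟨?_, ?_⟩⟩
  · by_contra hc
    push Not at hc
    obtain ⟨u, hu, hue⟩ := intermediate_value_Icc ht.2
      (hφ.continuousOn (s := Set.Icc t b)) ⟨hc.le, (by linarith : -K ≤ φ b)⟩
    have h3 := hamax ⟨⟨by linarith [hu.1, ht.1], hu.2⟩, hue⟩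
    have : t = a := le_antisymm (by linarith [hu.1]) ht.1
    rw [this] at hc; linarith
  · by_contra hc
    push Not at hc
    obtain ⟨u, hu, hue⟩ := intermediate_value_Icc ht.1
      (hφ.continuousOn (s := Set.Icc a t)) ⟨(by linarith : φ a ≤ K), hc.le⟩
    have h3 := hbmin ⟨⟨by linarith [hu.1], by linarith [hu.2, ht.2]⟩, hue⟩
    have : t = b := le_antisymm ht.2 (by linarith [hu.2])
    rw [this] at hc; linarith

lemma lift_V (G : V2 → V2) (hG : IsLift G) (v : ℤ × ℤ) (z : V2) (j : ℤ) :
    G (z + (j:ℝ) • intVec v) = G z + (j:ℝ) • intVec v := by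
  have : (j:ℝ) • intVec v = intVec (j * v.1, j * v.2) := by
    simp [intVec]
  rw [this, hG]

lemma lift_W (G : V2 → V2) (hG : IsLift G) (v : ℤ × ℤ) (z : V2) (j : ℤ) :
    G (z + (j:ℝ) • perp (intVec v)) = G z + (j:ℝ) • perp (intVec v) := by
  have : (j:ℝ) • perp (intVec v) = intVec (-(j * v.2), j * v.1) := by
    simp [intVec, perp]
  rw [this, hG]

lemma core1 (V : V2) (hV : 0 < dot V V) (M K Bd : ℝ)
    (G : V2 → V2) (hGc : Continuous G) (hGM : ∀ z, |dot (G z - z) V| ≤ M)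
    (a b : ℝ → V2) (ha : Continuous a) (hb : Continuous b)
    (hdisj : ∀ s ∈ Set.Icc (0:ℝ) 1, ∀ t ∈ Set.Icc (0:ℝ) 1, ∀ j : ℤ,
      G (a t) ≠ b s + (j:ℝ) • perp V)
    (haK : ∀ t ∈ Set.Icc (0:ℝ) 1, |dot (a t) V| ≤ K)
    (hb0 : dot (b 0) V ≤ -(K + M)) (hb1 : K + M ≤ dot (b 1) V)
    (hbB : ∀ t ∈ Set.Icc (0:ℝ) 1, |dot (b t) (perp V)| ≤ Bd)
    (t : ℝ) (ht : t ∈ Set.Icc (0:ℝ) 1) (t' : ℝ) (ht' : t' ∈ Set.Icc (0:ℝ) 1) :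
    dot (G (a t)) (perp V) - dot (G (a t')) (perp V) ≤ 2 * Bd + dot V V := by
  by_contra hc
  push Not at hc
  set N := dot V V with hN
  set y := dot (G (a t)) (perp V)
  set y' := dot (G (a t')) (perp V)
  set j := ⌈(y' + Bd) / N⌉ with hj
  have hj1 : y' + Bd ≤ j * N := (div_le_iff₀ hV).1 (Int.le_ceil _)
  have hj2 : (j:ℝ) * N < y' + Bd + N := by
    have := Int.ceil_lt_add_one ((y' + Bd) / N)
    have h2 : ((j:ℝ) - 1) < (y' + Bd) / N := by rw [hj]; linarith
    have := (lt_div_iff₀ hV).1 h2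
    linarith
  have hmem : ∀ s ∈ Set.Icc (0:ℝ) 1, t' + s * (t - t') ∈ Set.Icc (0:ℝ) 1 := fun s hs => by
    obtain ⟨h1, h2⟩ := hs; obtain ⟨h3, h4⟩ := ht; obtain ⟨h5, h6⟩ := ht'
    constructor <;> nlinarith
  have hX : ∀ s ∈ Set.Icc (0:ℝ) 1, |dot (G (a (t' + s * (t - t')))) V| ≤ K + M := fun s hs => by
    have h1 := haK _ (hmem s hs)
    have h2 := hGM (a (t' + s * (t - t')))
    rw [dot_sub'] at h2
    rw [abs_le] at *
    constructor <;> linarith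
  have hYb : ∀ s, dot (b s + (j:ℝ) • perp V) (perp V) = dot (b s) (perp V) + j * N := fun s => by
    rw [dot_add', dot_smul', dot_perp_perp]
  have hXb : ∀ s, dot (b s + (j:ℝ) • perp V) V = dot (b s) V := fun s => by
    rw [dot_add', dot_smul', dot_perp']; ring
  obtain ⟨s, hs, u, hu, hsu⟩ := cross V hV (fun s => G (a (t' + s * (t - t'))))
    (fun s => b s + (j:ℝ) • perp V) (by fun_prop) (by fun_prop)
    (fun s hs => by
      have := (abs_le.1 (hX s hs)).1
      simp only [hXb]; linarith)
    (fun s hs => by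
      have := (abs_le.1 (hX s hs)).2
      simp only [hXb]; linarith)
    (fun s hs => by
      have := (abs_le.1 (hbB s hs)).1
      simp only [hYb, zero_mul, add_zero]
      change y' ≤ _
      linarith)
    (fun s hs => by
      have := (abs_le.1 (hbB s hs)).2
      simp only [hYb, one_mul, add_sub_cancel]
      change _ ≤ y
      linarith)
  exact hdisj s hs _ (hmem u hu) j hsu

lemma core2 (v : ℤ × ℤ) (hV : 0 < dot (intVec v) (intVec v)) (M K Bd C1 : ℝ)
    (G : V2 → V2) (hGc : Continuous G) (hGl : IsLift G) (hGi : Function.Injective G)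
    (hGM : ∀ z, |dot (G z - z) (intVec v)| ≤ M)
    (a : ℝ → V2) (ha : Continuous a)
    (hK : dot (intVec v) (intVec v) + 2 * M ≤ K)
    (ha0 : dot (a 0) (intVec v) = -K) (ha1 : dot (a 1) (intVec v) = K)
    (haB : ∀ t ∈ Set.Icc (0:ℝ) 1, |dot (a t) (perp (intVec v))| ≤ Bd)
    (hC1 : ∀ t ∈ Set.Icc (0:ℝ) 1, ∀ t' ∈ Set.Icc (0:ℝ) 1,
      dot (G (a t)) (perp (intVec v)) - dot (G (a t')) (perp (intVec v)) ≤ C1)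
    (z : V2) (hz1 : |dot z (intVec v)| ≤ dot (intVec v) (intVec v))
    (hz2 : |dot z (perp (intVec v))| ≤ dot (intVec v) (intVec v)) :
    |dot (G z) (perp (intVec v)) - dot (G (a 0)) (perp (intVec v))| ≤
      C1 + Bd + 3 * dot (intVec v) (intVec v) := by
  set V := intVec v with hVd
  set N := dot V V with hN
  have m0 : (0:ℝ) ∈ Set.Icc (0:ℝ) 1 := by simp
  have m1 : (1:ℝ) ∈ Set.Icc (0:ℝ) 1 := by simp
  -- shift
  set j := ⌊(Bd + N) / N⌋ + 1 with hj
  have hj1 : Bd + N < j * N := by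
    have := Int.lt_floor_add_one ((Bd + N) / N)
    have h2 := (div_lt_iff₀ hV).1 this
    rw [hj]; push_cast; exact h2
  have hj2 : (j:ℝ) * N ≤ Bd + 2 * N := by
    have := Int.floor_le ((Bd + N) / N)
    have h2 := (le_div_iff₀ hV).1 this
    rw [hj]; push_cast; linarith
  obtain ⟨hz1a, hz1b⟩ := abs_le.1 hz1
  obtain ⟨hz2a, hz2b⟩ := abs_le.1 hz2
  have hYs : ∀ (x : V2) (r : ℝ), dot (x + r • perp V) (perp V) = dot x (perp V) + r * N :=
    fun x r => by rw [dot_add', dot_smul', dot_perp_perp]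
  have hXs : ∀ (x : V2) (r : ℝ), dot (x + r • perp V) V = dot x V := fun x r => by
    rw [dot_add', dot_smul', dot_perp']; ring
  have hXG : ∀ r : ℝ, |dot (G (z + r • perp V)) V| ≤ N + M := fun r => by
    have h2 := hGM (z + r • perp V)
    rw [dot_sub', hXs] at h2
    rw [abs_le] at *
    constructor <;> linarith
  have hXa0 : dot (G (a 0)) V ≤ -(N + M) := by
    have h2 := (abs_le.1 (hGM (a 0))).2
    rw [dot_sub'] at h2
    linarith
  have hXa1 : N + M ≤ dot (G (a 1)) V := by
    have h2 := (abs_le.1 (hGM (a 1))).1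
    rw [dot_sub'] at h2
    linarith
  rw [abs_le]
  constructor
  · by_contra hc
    push Not at hc
    obtain ⟨n, hn⟩ := exists_nat_gt
      ((dot (G (a 0)) (perp V) + C1 - j * N - dot (G z) (perp V)) / N)
    have hn' := (div_lt_iff₀ hV).1 hn
    have hGn : G (z + (n:ℝ) • perp V) = G z + (n:ℝ) • perp V := by
      exact_mod_cast lift_W G hGl v z n
    obtain ⟨s, hs, t, ht, hst⟩ := cross V hV (fun t => G (z + (t * n) • perp V))
      (fun s => G (a s) + (-j:ℝ) • perp V) (by fun_prop) (by fun_prop)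
      (fun t ht => by
        have := (abs_le.1 (hXG (t * n))).1
        simp only [hXs]; linarith)
      (fun t ht => by
        have := (abs_le.1 (hXG (t * n))).2
        simp only [hXs]; linarith)
      (fun s hs => by
        have := hC1 0 m0 s hs
        simp only [hYs, zero_mul, zero_smul, add_zero]
        linarith)
      (fun s hs => by
        have := hC1 s hs 0 m0
        simp only [one_mul, hGn, hYs]
        linarith)
    have h3 : G (a s) + (-j:ℝ) • perp V = G (a s + (-j:ℝ) • perp V) := by
      have := lift_W G hGl v (a s) (-j)
      push_cast at this
      exact this.symm
    simp only [h3] at hst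
    have h4 := congrArg (fun x => dot x (perp V)) (hGi hst)
    simp only [hYs] at h4
    have h5 := (abs_le.1 (haB s hs)).2
    have h6 : 0 ≤ t * n * N := by have := ht.1; positivity
    linarith
  · by_contra hc
    push Not at hc
    obtain ⟨n, hn⟩ := exists_nat_gt
      ((dot (G z) (perp V) - (dot (G (a 0)) (perp V) - C1 + j * N)) / N)
    have hn' := (div_lt_iff₀ hV).1 hn
    have hGn : G (z + (-n:ℝ) • perp V) = G z + (-n:ℝ) • perp V := by
      exact_mod_cast lift_W G hGl v z (-n)
    obtain ⟨s, hs, t, ht, hst⟩ := cross V hV (fun t => G (z + ((1 - t) * (-n)) • perp V))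
      (fun s => G (a s) + (j:ℝ) • perp V) (by fun_prop) (by fun_prop)
      (fun t ht => by
        have := (abs_le.1 (hXG ((1 - t) * (-n)))).1
        simp only [hXs]; linarith)
      (fun t ht => by
        have := (abs_le.1 (hXG ((1 - t) * (-n)))).2
        simp only [hXs]; linarith)
      (fun s hs => by
        have := hC1 0 m0 s hs
        simp only [sub_zero, one_mul, hGn, hYs]
        linarith)
      (fun s hs => by
        have := hC1 s hs 0 m0
        simp only [hYs, sub_self, zero_mul, zero_smul, add_zero]
        linarith)
    have h3 : G (a s) + (j:ℝ) • perp V = G (a s + (j:ℝ) • perp V) :=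
      (lift_W G hGl v (a s) j).symm
    simp only [h3] at hst
    have h4 := congrArg (fun x => dot x (perp V)) (hGi hst)
    simp only [hYs] at h4
    have h5 := (abs_le.1 (haB s hs)).1
    have h6 : 0 ≤ (1 - t) * n * N := by
      have : 0 ≤ 1 - t := by linarith [ht.2]
      positivity
    nlinarith

/-- reduction of a point modulo multiples of a vector -/
lemma reduce (N x c : ℝ) (hN : 0 < N) : ∃ i : ℤ, c ≤ x + i * N ∧ x + i * N < c + N := by
  refine ⟨⌈(c - x) / N⌉, ?_, ?_⟩
  · have := (div_le_iff₀ hN).1 (Int.le_ceil ((c - x) / N))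
    linarith
  · have h := Int.ceil_lt_add_one ((c - x) / N)
    have h2 : ((⌈(c - x) / N⌉ : ℝ) - 1) < (c - x) / N := by linarith
    have := (lt_div_iff₀ hN).1 h2
    linarith

lemma core3 (v : ℤ × ℤ) (hV : 0 < dot (intVec v) (intVec v)) (M K Bd C1 : ℝ)
    (G : V2 → V2) (hGc : Continuous G) (hGl : IsLift G) (hGi : Function.Injective G)
    (hGM : ∀ z, |dot (G z - z) (intVec v)| ≤ M)
    (a : ℝ → V2) (ha : Continuous a)
    (hK : dot (intVec v) (intVec v) + 2 * M ≤ K)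
    (ha0 : dot (a 0) (intVec v) = -K) (ha1 : dot (a 1) (intVec v) = K)
    (haB : ∀ t ∈ Set.Icc (0:ℝ) 1, |dot (a t) (perp (intVec v))| ≤ Bd)
    (hC1 : ∀ t ∈ Set.Icc (0:ℝ) 1, ∀ t' ∈ Set.Icc (0:ℝ) 1,
      dot (G (a t)) (perp (intVec v)) - dot (G (a t')) (perp (intVec v)) ≤ C1)
    (z : V2) :
    |dot (G z - z) (perp (intVec v)) - dot (G (a 0)) (perp (intVec v))| ≤
      C1 + Bd + 4 * dot (intVec v) (intVec v) := by
  obtain ⟨i, hi1, hi2⟩ := reduce (dot (intVec v) (intVec v)) (dot z (intVec v)) 0 hV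
  obtain ⟨l, hl1, hl2⟩ := reduce (dot (intVec v) (intVec v)) (dot z (perp (intVec v))) 0 hV
  have e1 : dot (z + (i:ℝ) • intVec v + (l:ℝ) • perp (intVec v)) (intVec v)
      = dot z (intVec v) + i * dot (intVec v) (intVec v) := by
    rw [dot_add', dot_add', dot_smul', dot_smul', dot_perp']; ring
  have e2 : dot (z + (i:ℝ) • intVec v + (l:ℝ) • perp (intVec v)) (perp (intVec v))
      = dot z (perp (intVec v)) + l * dot (intVec v) (intVec v) := by
    rw [dot_add', dot_add', dot_smul', dot_smul', dot_perp, dot_perp_perp]; ring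
  have := core2 v hV M K Bd C1 G hGc hGl hGi hGM a ha hK ha0 ha1 haB hC1
    (z + (i:ℝ) • intVec v + (l:ℝ) • perp (intVec v))
    (by rw [e1, abs_le]; constructor <;> linarith) (by rw [e2, abs_le]; constructor <;> linarith)
  rw [lift_W G hGl, lift_V G hGl] at this
  rw [dot_add', dot_add', dot_smul', dot_smul', dot_perp, dot_perp_perp] at this
  rw [dot_sub']
  rw [abs_le] at *
  constructor <;> linarith

lemma D_mul (F : V2 → V2) (c : V2) (T : ℝ)
    (hT : ∀ (n : ℕ) (z z' : V2), |dot (F^[n] z - z) c - dot (F^[n] z' - z') c| ≤ T)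
    (n m : ℕ) (z : V2) :
    |dot (F^[n * m] z - z) c - m * dot (F^[n] z - z) c| ≤ m * T := by
  induction m with
  | zero => simp [dot]
  | succ m ih =>
    have e : F^[n * (m + 1)] z = F^[n] (F^[n * m] z) := by
      rw [← Function.iterate_add_apply]; congr 1; ring
    have h1 := hT n (F^[n * m] z) z
    rw [e]
    push_cast
    simp only [dot_sub'] at *
    rw [abs_le] at *
    constructor <;> linarith

lemma rot_eq (F : V2 → V2) (c : V2) (T : ℝ)
    (hT : ∀ (n : ℕ) (z z' : V2), |dot (F^[n] z - z) c - dot (F^[n] z' - z') c| ≤ T)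
    (r1 r2 : V2) (h1 : r1 ∈ RotSet F) (h2 : r2 ∈ RotSet F) : dot r1 c = dot r2 c := by
  obtain ⟨n, x, hn, hx⟩ := h1
  obtain ⟨m, y, hm, hy⟩ := h2
  have hT0 : 0 ≤ T := le_trans (abs_nonneg _) (hT 0 0 0)
  have hdc : Continuous fun z : V2 => dot z c := dot_cont _ continuous_id c
  have t1 := (hdc.tendsto r1).comp hx
  have t2 := (hdc.tendsto r2).comp hy
  have t3 := (t1.sub t2).abs
  have hn' : Tendsto (fun i => ((n i : ℝ))⁻¹) atTop (𝓝 0) :=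
    tendsto_inv_atTop_zero.comp (tendsto_natCast_atTop_atTop.comp hn)
  have hm' : Tendsto (fun i => ((m i : ℝ))⁻¹) atTop (𝓝 0) :=
    tendsto_inv_atTop_zero.comp (tendsto_natCast_atTop_atTop.comp hm)
  have t4 : Tendsto (fun i => 2 * T * ((n i : ℝ))⁻¹ + T * ((m i : ℝ))⁻¹) atTop (𝓝 0) := by
    simpa using (hn'.const_mul (2 * T)).add (hm'.const_mul T)
  have key : |dot r1 c - dot r2 c| ≤ 0 := by
    refine le_of_tendsto_of_tendsto t3 t4 ?_
    filter_upwards [hn.eventually_ge_atTop 1, hm.eventually_ge_atTop 1] with i hi1 hi2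
    simp only [Function.comp, dot_smul']
    have b1 := D_mul F c T hT (n i) (m i) (x i)
    have b2 := D_mul F c T hT (m i) (n i) (y i)
    have b3 := hT (n i * m i) (x i) (y i)
    rw [mul_comm (m i) (n i)] at b2
    set a := dot (F^[n i] (x i) - x i) c
    set b := dot (F^[m i] (y i) - y i) c
    have hN : (1:ℝ) ≤ n i := by exact_mod_cast hi1
    have hM : (1:ℝ) ≤ m i := by exact_mod_cast hi2
    have hN0 : (0:ℝ) < n i := by linarith
    have hM0 : (0:ℝ) < m i := by linarith
    have b4 : |m i * a - n i * b| ≤ (2 * m i + n i) * T := by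
      have : T ≤ m i * T := by nlinarith
      rw [abs_le] at *
      constructor <;> linarith
    have e1 : ((n i : ℝ))⁻¹ * a - ((m i : ℝ))⁻¹ * b
      = (m i * a - n i * b) / (n i * m i) := by field_simp
    have e2 : 2 * T * ((n i : ℝ))⁻¹ + T * ((m i : ℝ))⁻¹
      = (2 * m i + n i) * T / (n i * m i) := by field_simp
    rw [e1, e2, abs_div, abs_of_pos (mul_pos hN0 hM0)]
    gcongr
  have := abs_nonpos_iff.1 key
  linarith

lemma unbounded_dev (F : V2 → V2) (V : V2) (hV : 0 < dot V V)
    (hint : (interior (RotSet F)).Nonempty) (T : ℝ) :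
    ∃ (n : ℕ) (z z' : V2), T < dot (F^[n] z - z) V - dot (F^[n] z' - z') V := by
  by_contra hc
  push Not at hc
  obtain ⟨r, hr⟩ := hint
  have hcont : Continuous fun e : ℝ => r + e • V := by fun_prop
  have h0 : (fun e : ℝ => r + e • V) ⁻¹' interior (RotSet F) ∈ 𝓝 (0:ℝ) :=
    (isOpen_interior.preimage hcont).mem_nhds (by simpa using hr)
  obtain ⟨ε, hε, hball⟩ := Metric.mem_nhds_iff.1 h0
  have hmem : ε / 2 ∈ Metric.ball (0:ℝ) ε := by
    rw [Metric.mem_ball, Real.dist_eq, sub_zero, abs_of_pos (by linarith)]; linarith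
  have h1 := interior_subset (hball hmem)
  have h2 := rot_eq F V T (fun n z z' => by
    have a1 := hc n z z'
    have a2 := hc n z' z
    rw [abs_le]; constructor <;> linarith) _ _ h1 (interior_subset hr)
  rw [dot_add', dot_smul'] at h2
  have : 0 < ε / 2 * dot V V := by positivity
  linarith

lemma iter_lift (F : V2 → V2) (hF : IsLift F) (n : ℕ) : IsLift F^[n] := by
  induction n with
  | zero => intro z u; rfl
  | succ n ih =>
    intro z u
    rw [Function.iterate_succ_apply', Function.iterate_succ_apply', ih, hF]

lemma core4 (v : ℤ × ℤ) (hV : 0 < dot (intVec v) (intVec v)) (M : ℝ) (hM : 0 < M)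
    (h : V2 → V2) (hhc : Continuous h) (hhl : IsLift h) (hhi : Function.Injective h)
    (hint : (interior (RotSet h)).Nonempty) :
    ∃ C : ℝ, ∀ G : V2 → V2, Continuous G → IsLift G → Function.Injective G →
      (∀ z, |dot (G z - z) (intVec v)| ≤ M) → (∀ z, G (h z) = h (G z)) →
      ∀ z z', |dot (G z - z) (perp (intVec v)) - dot (G z' - z') (perp (intVec v))| ≤ C := by
  set V := intVec v with hVd
  set N := dot V V with hN
  set K := N + 2 * M with hK
  set P := K + M + M + 1 + N with hP
  obtain ⟨n, w1, w2, hw⟩ := unbounded_dev h V hV hint (2 * P + N)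
  obtain ⟨s, hs1, hs2⟩ := reduce N (dot (h^[n] w1 - w1) V) P hV
  set H : V2 → V2 := fun z => h^[n] z + (s:ℝ) • V with hH
  have hnc : Continuous h^[n] := hhc.iterate n
  have hHc : Continuous H := by fun_prop
  have hHl : IsLift H := fun z u => by
    simp only [hH, iter_lift h hhl n z u]; abel
  have hHi : Function.Injective H := fun x y hxy => by
    simp only [hH, add_left_inj] at hxy
    exact hhi.iterate n hxy
  have hVs : ∀ (x : V2) (r : ℝ), dot (x + r • V) V = dot x V + r * N := fun x r => by
    rw [dot_add', dot_smul']
  have hH1 : P ≤ dot (H w1) V - dot w1 V := by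
    simp only [hH, hVs]; rw [dot_sub'] at hs1; linarith
  have hH2 : dot (H w2) V - dot w2 V ≤ -P := by
    simp only [hH, hVs]; rw [dot_sub'] at hs2; rw [dot_sub', dot_sub'] at hw; linarith
  obtain ⟨i1, hi1, hi1'⟩ := reduce N (dot w1 V) (-M - 1 - N) hV
  obtain ⟨i2, hi2, hi2'⟩ := reduce N (dot w2 V) (M + 1) hV
  set z1 := w1 + (i1:ℝ) • V with hz1
  set z2 := w2 + (i2:ℝ) • V with hz2
  have hz1X : dot z1 V < -M := by rw [hz1, hVs]; linarith
  have hz2X : M < dot z2 V := by rw [hz2, hVs]; linarith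
  have hHz1 : K + M ≤ dot (H z1) V := by
    rw [hz1, lift_V H hHl, ← hVd, hVs]; linarith
  have hHz2 : dot (H z2) V ≤ -(K + M) := by
    rw [hz2, lift_V H hHl, ← hVd, hVs]; linarith
  obtain ⟨j1, hj1⟩ := exists_nat_gt ((dot (H z1) V + (K + M)) / N)
  obtain ⟨j2, hj2⟩ := exists_nat_gt (((K + M) - dot (H z2) V) / N)
  have hj1' := (div_lt_iff₀ hV).1 hj1
  have hj2' := (div_lt_iff₀ hV).1 hj2
  set A0 : ℝ → V2 := fun t => z1 + ((1 - t) * (-j1)) • V with hA0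
  set B : ℝ → V2 := fun t => z2 + (t * j2) • V with hB
  have hA0c : Continuous A0 := by fun_prop
  have hBc : Continuous B := by fun_prop
  have hA0X : ∀ t ∈ Set.Icc (0:ℝ) 1, dot (A0 t) V < -M := fun t ht => by
    simp only [hA0, hVs]
    have : 0 ≤ (1 - t) * j1 * N := by
      have : 0 ≤ 1 - t := by linarith [ht.2]
      positivity
    nlinarith
  have hBX : ∀ t ∈ Set.Icc (0:ℝ) 1, M < dot (B t) V := fun t ht => by
    simp only [hB, hVs]
    have : 0 ≤ t * j2 * N := by
      have := ht.1
      positivity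
    linarith
  have hK0 : 0 < K := by positivity
  have hA00 : dot (H (A0 0)) V ≤ -K := by
    have e : H (A0 0) = H z1 + (-j1:ℝ) • V := by
      have := lift_V H hHl v z1 (-j1)
      push_cast at this
      simpa [hA0] using this
    rw [e, hVs]; linarith
  have hA01 : K ≤ dot (H (A0 1)) V := by
    have e : A0 1 = z1 := by simp [hA0]
    rw [e]; linarith
  have hB0 : dot (H (B 0)) V ≤ -(K + M) := by
    have e : B 0 = z2 := by simp [hB]
    rw [e]; linarith
  have hB1 : K + M ≤ dot (H (B 1)) V := by
    have e : H (B 1) = H z2 + (j2:ℝ) • V := by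
      have := lift_V H hHl v z2 j2
      push_cast at this
      simpa [hB] using this
    rw [e, hVs]; linarith
  obtain ⟨p, q, hp0, hpq, hq1, hpK, hqK, hpqK⟩ := trunc (fun t => dot (H (A0 t)) V)
    (dot_cont _ (hHc.comp hA0c) V) K hK0 hA00 hA01
  set A : ℝ → V2 := fun t => A0 (p + t * (q - p)) with hA
  have hAc : Continuous A := by fun_prop
  have hmem : ∀ t ∈ Set.Icc (0:ℝ) 1, p + t * (q - p) ∈ Set.Icc p q := fun t ht => by
    obtain ⟨h1, h2⟩ := ht
    constructor <;> nlinarith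
  have hAX : ∀ t ∈ Set.Icc (0:ℝ) 1, dot (A t) V < -M := fun t ht =>
    hA0X _ ⟨by linarith [(hmem t ht).1], by linarith [(hmem t ht).2]⟩
  have hAK : ∀ t ∈ Set.Icc (0:ℝ) 1, |dot (H (A t)) V| ≤ K := fun t ht => hpqK _ (hmem t ht)
  have hAe0 : dot (H (A 0)) V = -K := by
    simp only [hA, zero_mul, add_zero]; exact hpK
  have hAe1 : dot (H (A 1)) V = K := by
    simp only [hA, one_mul, add_sub_cancel]; exact hqK
  obtain ⟨Ba, hBa⟩ := (isCompact_Icc (a := (0:ℝ)) (b := 1)).exists_bound_of_continuousOn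
    (dot_cont _ (hHc.comp hAc) (perp V)).continuousOn
  obtain ⟨Bb, hBb⟩ := (isCompact_Icc (a := (0:ℝ)) (b := 1)).exists_bound_of_continuousOn
    (dot_cont _ (hHc.comp hBc) (perp V)).continuousOn
  refine ⟨2 * ((2 * Bb + N) + Ba + 4 * N), fun G hGc hGl hGi hGM hGh z z' => ?_⟩
  have hGH : ∀ z, G (H z) = H (G z) := fun z => by
    have e : G (h^[n] z) = h^[n] (G z) :=
      (Function.Commute.iterate_right (f := G) (g := h) hGh n) z
    simp only [hH]
    rw [hVd, lift_V G hGl, e]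
  have hdisj : ∀ s ∈ Set.Icc (0:ℝ) 1, ∀ t ∈ Set.Icc (0:ℝ) 1, ∀ j : ℤ,
      G (H (A t)) ≠ H (B s) + (j:ℝ) • perp V := fun s hs t ht j he => by
    rw [hGH, ← lift_W H hHl] at he
    have h1 := congrArg (fun x => dot x V) (hHi he)
    simp only [dot_add', dot_smul', ← hVd, dot_perp'] at h1
    have h2 := (abs_le.1 (hGM (A t))).2
    rw [dot_sub'] at h2
    have h3 := hAX t ht
    have h4 := hBX s hs
    linarith
  have hC1 := core1 V hV M K Bb G hGc hGM (fun t => H (A t)) (fun t => H (B t))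
    (hHc.comp hAc) (hHc.comp hBc) hdisj hAK hB0 hB1 hBb
  have k := core3 v hV M K Ba (2 * Bb + N) G hGc hGl hGi hGM (fun t => H (A t)) (hHc.comp hAc)
    le_rfl hAe0 hAe1 hBa (fun t ht t' ht' => hC1 t ht t' ht')
  have k1 := k z
  have k2 := k z'
  simp only [← hVd, ← hN] at k1 k2
  rw [abs_le] at *
  constructor <;> linarith

lemma disp_bdd (F : V2 → V2) (hFc : Continuous F) (hFl : IsLift F) (c : V2) :
    ∃ C : ℝ, ∀ z, |dot (F z - z) c| ≤ C := by
  obtain ⟨C, hC⟩ := ((isCompact_Icc (a := (0:ℝ)) (b := 1)).prod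
    (isCompact_Icc (a := (0:ℝ)) (b := 1))).exists_bound_of_continuousOn
    (dot_cont (fun z => F z - z) (by fun_prop) c).continuousOn
  refine ⟨C, fun z => ?_⟩
  have h1 := hC (Int.fract z.1, Int.fract z.2)
    ⟨⟨Int.fract_nonneg _, (Int.fract_lt_one _).le⟩, ⟨Int.fract_nonneg _, (Int.fract_lt_one _).le⟩⟩
  have e : z = (Int.fract z.1, Int.fract z.2) + intVec (⌊z.1⌋, ⌊z.2⌋) := by
    ext <;> simp [intVec]
  have e2 : F z - z = F (Int.fract z.1, Int.fract z.2) - (Int.fract z.1, Int.fract z.2) := by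
    conv_lhs => rw [e, hFl]
    abel
  rw [e2]
  exact h1

lemma iter_disp (F : V2 → V2) (c : V2) (C : ℝ) (hC : ∀ z, |dot (F z - z) c| ≤ C) (r : ℕ) (z : V2) :
    |dot (F^[r] z - z) c| ≤ r * C := by
  induction r with
  | zero => simp [dot]
  | succ r ih =>
    have h1 := hC (F^[r] z)
    rw [Function.iterate_succ_apply']
    push_cast
    simp only [dot_sub'] at *
    rw [abs_le] at *
    constructor <;> linarith

lemma dev_of_pow (F : V2 → V2) (hFc : Continuous F) (hFl : IsLift F) (c : V2) (k : ℕ) (hk : 1 ≤ k)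
    (C : ℝ) (hC : ∀ (m : ℕ) (z z' : V2),
      |dot (F^[k * m] z - z) c - dot (F^[k * m] z' - z') c| ≤ C) :
    ∃ T : ℝ, ∀ (n : ℕ) (z z' : V2), |dot (F^[n] z - z) c - dot (F^[n] z' - z') c| ≤ T := by
  obtain ⟨C0, hC0⟩ := disp_bdd F hFc hFl c
  have hC0' : 0 ≤ C0 := le_trans (abs_nonneg _) (hC0 0)
  refine ⟨C + 2 * (k * C0), fun n z z' => ?_⟩
  have e : ∀ z, F^[n] z = F^[n % k] (F^[k * (n / k)] z) := fun z => by
    rw [← Function.iterate_add_apply, Nat.mod_add_div]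
  have hb : ∀ x, |dot (F^[n % k] x - x) c| ≤ k * C0 := fun x => by
    refine (iter_disp F c C0 hC0 _ x).trans ?_
    have : ((n % k : ℕ) : ℝ) ≤ k := by exact_mod_cast (Nat.mod_lt n hk).le
    gcongr
  have h1 := hb (F^[k * (n / k)] z)
  have h2 := hb (F^[k * (n / k)] z')
  have h3 := hC (n / k) z z'
  rw [e z, e z']
  simp only [dot_sub'] at *
  rw [abs_le] at *
  constructor <;> linarith

/-- Theorem A (case 1): there are no commuting lifts f, h of commuting torus
homeomorphisms homotopic to the identity such that ρ(f) is a nondegenerate segment of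
rational slope containing a rational point (with some power of f being annular, as
guaranteed by the Guelman–Koropecki–Tal theorem) and ρ(h) has nonempty interior. -/
theorem stmt15 (f h : Equiv.Perm V2)
    (hfc : Continuous ⇑f) (hfc' : Continuous ⇑f.symm)
    (hhc : Continuous ⇑h) (hhc' : Continuous ⇑h.symm)
    (hlf : IsLift ⇑f) (hlh : IsLift ⇑h)
    (hcomm : ∀ z : V2, f (h z) = h (f z))
    (p q : V2) (hpq : p ≠ q) (hseg : RotSet ⇑f = segment ℝ p q)
    (hslope : ∃ v : ℤ × ℤ, v ≠ 0 ∧ ∃ t : ℝ, q - p = t • intVec v)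
    (hrat : ∃ r : ℚ × ℚ, ((r.1 : ℝ), (r.2 : ℝ)) ∈ RotSet ⇑f)
    (hann : ∃ k : ℕ, 1 ≤ k ∧ ∃ v : ℤ × ℤ, v ≠ 0 ∧ ∃ M > (0 : ℝ),
      ∀ (n : ℤ) (z : V2), |dot (((f ^ k) ^ n) z - z) (intVec v)| ≤ M)
    (hint : (interior (RotSet ⇑h)).Nonempty) :
    False := by

  obtain ⟨k, hk, v, hv, M, hM, hfM⟩ := hann
  have hV : 0 < dot (intVec v) (intVec v) := by
    have h1 : v.1 ≠ 0 ∨ v.2 ≠ 0 := by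
      by_contra hc
      push Not at hc
      exact hv (Prod.ext hc.1 hc.2)
    simp only [dot, intVec]
    rcases h1 with h1 | h1
    · have : (v.1 : ℝ) ≠ 0 := by exact_mod_cast h1
      nlinarith [mul_self_pos.2 this, mul_self_nonneg (v.2 : ℝ)]
    · have : (v.2 : ℝ) ≠ 0 := by exact_mod_cast h1
      nlinarith [mul_self_pos.2 this, mul_self_nonneg (v.1 : ℝ)]
  have hGM : ∀ (m : ℕ) (z : V2), |dot (f^[k * m] z - z) (intVec v)| ≤ M := fun m z => by
    have := hfM m z
    rwa [zpow_natCast, ← pow_mul, ← Equiv.Perm.iterate_eq_pow] at this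
  obtain ⟨C, hC⟩ := core4 v hV M hM h hhc hlh h.injective hint
  obtain ⟨T1, hT1⟩ := dev_of_pow f hfc hlf (intVec v) k hk (2 * M) (fun m z z' => by
    have h1 := hGM m z
    have h2 := hGM m z'
    rw [abs_le] at *
    constructor <;> linarith)
  obtain ⟨T2, hT2⟩ := dev_of_pow f hfc hlf (perp (intVec v)) k hk C (fun m z z' =>
    hC f^[k * m] (hfc.iterate _) (iter_lift _ hlf _) (f.injective.iterate _) (hGM m)
      (fun z => (Function.Commute.iterate_left (f := f) (g := h) hcomm (k * m)) z) z z')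
  have hp : p ∈ RotSet f := hseg ▸ left_mem_segment ℝ p q
  have hq : q ∈ RotSet f := hseg ▸ right_mem_segment ℝ p q
  exact hpq (eq_of_dots (intVec v) hV p q (rot_eq f _ T1 hT1 p q hp hq)
    (rot_eq f _ T2 hT2 p q hp hq))
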